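/- arXiv:1711.01805 — 2 statements merged into one kernel-verified Lean document; each statement's English description precedes it below -/
import Mathlib

section
/- For every λ ∈ (−1, 1], every real a ≠ 0 with s = ia, and every α ∈ ℂ, the operator B(λ, s, α) on ℓ²(ℤ,ℂ) ⊕ ℓ²(ℤ,ℂ) is homogeneous: its spectrum is contained in the closed unit disc, and for every θ ∈ ℝ and every c ∈ ℂ with |c| < 1, the operator 1 − conj(c)·B(λ, s, α) is invertible and e^{iθ}(B(λ, s, α) − c·1)(1 − conj(c)·B(λ, s, α))⁻¹ is unitarily equivalent to B(λ, s, α). -/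
noncomputable section

open ContinuousLinearMap

/-- The Hilbert space `ℓ²(ℤ, ℂ)`. -/
abbrev H : Type := lp (fun _ : ℤ => ℂ) 2

/-- The standard orthonormal basis vectors of `ℓ²(ℤ, ℂ)`. -/
def e (n : ℤ) : H := lp.single 2 n 1

/-- The `2 × 2` upper-triangular block operator `[[T₁, S], [0, T₂]]` on the Hilbert space
direct sum `E ⊕ E = WithLp 2 (E × E)`. -/
def blockOp {E : Type*} [NormedAddCommGroup E] [NormedSpace ℂ E]
    (T₁ S T₂ : E →L[ℂ] E) : WithLp 2 (E × E) →L[ℂ] WithLp 2 (E × E) :=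
  ((WithLp.prodContinuousLinearEquiv 2 ℂ E E).symm :
      E × E →L[ℂ] WithLp 2 (E × E)) ∘L
    ((((T₁ ∘L fst ℂ E E) + (S ∘L snd ℂ E E)).prod (T₂ ∘L snd ℂ E E)) ∘L
      ((WithLp.prodContinuousLinearEquiv 2 ℂ E E) :
        WithLp 2 (E × E) →L[ℂ] E × E))

/-- Unitary equivalence of bounded operators on (possibly different) complex Hilbert spaces:
there is a unitary (= surjective linear isometry) `U` with `U A U⁻¹ = B`. -/
def UnitarilyEquiv {E F : Type*} [NormedAddCommGroup E] [NormedSpace ℂ E]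
    [NormedAddCommGroup F] [NormedSpace ℂ F] (A : E →L[ℂ] E) (B : F →L[ℂ] F) : Prop :=
  ∃ U : E ≃ₗᵢ[ℂ] F, ∀ x, U (A x) = B (U x)

/-- The Möbius transform `e^{iθ} (T - c·1)(1 - c̄·T)⁻¹` of an operator. -/
def mobius {E : Type*} [NormedAddCommGroup E] [NormedSpace ℂ E] [CompleteSpace E]
    (θ : ℝ) (c : ℂ) (T : E →L[ℂ] E) : E →L[ℂ] E :=
  Complex.exp (θ * Complex.I) •
    ((T - c • (1 : E →L[ℂ] E)) * Ring.inverse (1 - (starRingEnd ℂ c) • T))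

/-- A bounded operator on a complex Hilbert space is homogeneous if its spectrum lies in the
closed unit disc and all its Möbius transforms are unitarily equivalent to it. -/
def Homogeneous {E : Type*} [NormedAddCommGroup E] [NormedSpace ℂ E] [CompleteSpace E]
    (T : E →L[ℂ] E) : Prop :=
  spectrum ℂ T ⊆ Metric.closedBall 0 1 ∧
    ∀ (θ : ℝ) (c : ℂ), ‖c‖ < 1 →
      IsUnit (1 - (starRingEnd ℂ c) • T) ∧ UnitarilyEquiv (mobius θ c T) T

/-- A bounded operator is irreducible if the only closed subspaces invariant under both the
operator and its adjoint are `{0}` and the whole space. -/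
def IrreducibleOp {E : Type*} [NormedAddCommGroup E] [InnerProductSpace ℂ E] [CompleteSpace E]
    (T : E →L[ℂ] E) : Prop :=
  ∀ M : Submodule ℂ E, IsClosed (M : Set E) → (∀ x ∈ M, T x ∈ M) →
    (∀ x ∈ M, ContinuousLinearMap.adjoint T x ∈ M) → M = ⊥ ∨ M = ⊤

/-- Weight sequence of the shift `B_{λ, ia}`. -/
def wB (l a : ℝ) (n : ℤ) : ℂ :=
  ((n : ℂ) + (1 + (l : ℂ)) / 2 + Complex.I * (a : ℂ)) /
    ((n : ℂ) + (1 + (l : ℂ)) / 2 - Complex.I * (a : ℂ))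

/-- Weight sequence of the shift `T(a, b)`. -/
def wT (a b : ℝ) (n : ℤ) : ℂ := (Real.sqrt (((n : ℝ) + a) / ((n : ℝ) + b)) : ℂ)

/-- Weight sequence of the shift `S[λ]`. -/
def wS (l : ℝ) (n : ℤ) : ℂ := ((l : ℂ) + 2 * (n : ℂ) + 1)⁻¹

open scoped InnerProductSpace

lemma inner_e_left (n : ℤ) (x : H) : ⟪e n, x⟫_ℂ = x n := by
  simp [e, lp.inner_single_left]

lemma inner_e_e (m n : ℤ) : ⟪e m, e n⟫_ℂ = if m = n then 1 else 0 := by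
  rw [inner_e_left, e, lp.single_apply, Pi.single_apply]

lemma norm_e (n : ℤ) : ‖e n‖ = 1 := by
  simp [e, lp.norm_single]

/-- Continuous linear maps on `H` are determined by their values on the standard basis. -/
lemma ext_e {A B : H →L[ℂ] H} (h : ∀ n, A (e n) = B (e n)) : A = B := by
  refine lp.ext_continuousLinearMap ENNReal.ofNat_ne_top fun i => ?_
  ext1
  simpa [e] using h i

/-- An orthonormal family indexed by `ℤ` is the image of the standard basis under an isometry. -/
lemma exists_isometry {v : ℤ → H} (hv : Orthonormal ℂ v) :
    ∃ V : H →ₗᵢ[ℂ] H, ∀ n, V (e n) = v n := by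
  refine ⟨hv.orthogonalFamily.linearIsometry, fun n => ?_⟩
  rw [e, OrthogonalFamily.linearIsometry_apply_single]
  simp

/-- Two orthonormal families whose matrices are adjoint to each other define a unitary. -/
lemma exists_unitary {v v' : ℤ → H} (hv : Orthonormal ℂ v) (hv' : Orthonormal ℂ v')
    (h : ∀ n m, ⟪v n, e m⟫_ℂ = ⟪e n, v' m⟫_ℂ) :
    ∃ V : H ≃ₗᵢ[ℂ] H, ∀ n, V (e n) = v n := by
  obtain ⟨V, hV⟩ := exists_isometry hv
  obtain ⟨V', hV'⟩ := exists_isometry hv'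
  have hadj : adjoint V.toContinuousLinearMap = V'.toContinuousLinearMap := by
    refine ext_e fun m => ?_
    ext n
    rw [← inner_e_left, ← inner_e_left, adjoint_inner_right]
    simpa [hV, hV'] using h n m
  have hcomp : V.toContinuousLinearMap ∘L V'.toContinuousLinearMap = 1 := by
    have := (norm_map_iff_adjoint_comp_self V'.toContinuousLinearMap).1 V'.norm_map
    rwa [← hadj, adjoint_adjoint, hadj] at this
  refine ⟨LinearIsometryEquiv.ofSurjective V fun x => ⟨V' x, ?_⟩, hV⟩
  exact congrArg (fun A : H →L[ℂ] H => A x) hcomp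

/-- A weighted shift with unimodular weights is a contraction. -/
lemma norm_shift_le {w : ℤ → ℂ} (hw : ∀ n, ‖w n‖ = 1) {T : H →L[ℂ] H}
    (hT : ∀ n, T (e n) = w n • e (n + 1)) : ‖T‖ ≤ 1 := by
  have ho : Orthonormal ℂ fun n => w n • e (n + 1) := by
    refine ⟨fun n => by simp [norm_smul, hw, norm_e], fun m n hmn => ?_⟩
    simp [inner_smul_left, inner_smul_right, inner_e_e, hmn]
  obtain ⟨V, hV⟩ := exists_isometry ho
  have : T = V.toContinuousLinearMap := ext_e fun n => by simp [hT, hV]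
  rw [this]
  exact V.norm_toContinuousLinearMap_le

/-- A family of holomorphic functions solving a homogeneous linear three-term recursive system of
differential equations with vanishing initial values vanishes identically. -/
lemma eq_zero_of_hasDerivAt {F : Type*} [NormedAddCommGroup F] [NormedSpace ℂ F] [CompleteSpace F]
    {r : ℝ} {x y : ℤ → ℂ} {f : ℤ → ℂ → F}
    (hf : ∀ n, ∀ t ∈ Metric.ball (0 : ℂ) r,
      HasDerivAt (f n) (x n • f (n + 1) t + y n • f (n - 1) t) t)
    (h0 : ∀ n, f n 0 = 0) (n : ℤ) {t : ℂ} (ht : t ∈ Metric.ball (0 : ℂ) r) : f n t = 0 := by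
  have hr : 0 < r := Metric.pos_of_mem_ball ht
  have hd : ∀ n, DifferentiableOn ℂ (f n) (Metric.ball 0 r) := fun n t ht =>
    (hf n t ht).differentiableAt.differentiableWithinAt
  have hc : ∀ (k : ℕ) n, ContDiffAt ℂ k (f n) 0 := fun k n =>
    ((hd n).analyticAt (Metric.ball_mem_nhds 0 hr)).contDiffAt
  have hz : ∀ k n, iteratedDeriv k (f n) 0 = 0 := by
    intro k
    induction k with
    | zero => simpa using h0
    | succ k ih =>
      intro n
      have hev : deriv (f n) =ᶠ[nhds 0] (x n • f (n + 1) + y n • f (n - 1)) := by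
        filter_upwards [Metric.ball_mem_nhds (0 : ℂ) hr] with t ht
        simpa using (hf n t ht).deriv
      rw [iteratedDeriv_succ', hev.iteratedDeriv_eq, iteratedDeriv_add, iteratedDeriv_const_smul,
        iteratedDeriv_const_smul, ih, ih, smul_zero, smul_zero, add_zero]
      all_goals first | exact hc _ _ | exact (hc _ _).const_smul _
  have := Complex.hasSum_taylorSeries_on_ball (hd n) ht
  simp only [hz, smul_zero] at this
  exact this.unique hasSum_zero

/-- Raising coefficients of the skew-adjoint tridiagonal generator. -/
def genUp (κ a : ℝ) (n : ℤ) : ℂ := (n : ℂ) + κ + Complex.I * a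

/-- Lowering coefficients of the skew-adjoint tridiagonal generator. -/
def genDown (κ a : ℝ) (n : ℤ) : ℂ := (n : ℂ) - 1 + κ - Complex.I * a

/-- Powers of the generator `e n ↦ genUp n • e (n + 1) - genDown n • e (n - 1)` applied to the
standard basis. -/
def genPow (κ a : ℝ) : ℕ → ℤ → H
  | 0, n => e n
  | k + 1, n => genUp κ a n • genPow κ a k (n + 1) - genDown κ a n • genPow κ a k (n - 1)

lemma inner_e_genPow_succ (κ a : ℝ) (k : ℕ) (m n : ℤ) :
    ⟪e n, genPow κ a (k + 1) m⟫_ℂ = genUp κ a (n - 1) * ⟪e (n - 1), genPow κ a k m⟫_ℂ -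
      genDown κ a (n + 1) * ⟪e (n + 1), genPow κ a k m⟫_ℂ := by
  induction k generalizing m with
  | zero =>
    simp only [genPow, inner_sub_right, inner_smul_right, inner_e_e]
    by_cases h₁ : n = m + 1
    · subst h₁
      simp [show m + 1 ≠ m - 1 by lia, show m + 1 + 1 ≠ m by lia]
    · by_cases h₂ : n = m - 1
      · subst h₂
        simp [show m - 1 ≠ m + 1 by lia, show m - 1 - 1 ≠ m by lia]
      · simp [h₁, h₂, show n - 1 ≠ m by lia, show n + 1 ≠ m by lia]
  | succ k ih =>
    rw [genPow, inner_sub_right, inner_smul_right, inner_smul_right, ih, ih, genPow]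
    simp only [inner_sub_right, inner_smul_right]
    ring

lemma inner_genPow_e (κ a : ℝ) (k : ℕ) (n m : ℤ) :
    ⟪genPow κ a k n, e m⟫_ℂ = (-1) ^ k * ⟪e n, genPow κ a k m⟫_ℂ := by
  induction k generalizing n with
  | zero => simp [genPow]
  | succ k ih =>
    rw [inner_e_genPow_succ, genPow, inner_sub_left, inner_smul_left, inner_smul_left, ih, ih]
    have h₁ : (starRingEnd ℂ) (genUp κ a n) = genDown κ a (n + 1) := by
      simp [genUp, genDown]; ring
    have h₂ : (starRingEnd ℂ) (genDown κ a n) = genUp κ a (n - 1) := by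
      simp [genUp, genDown]
    rw [h₁, h₂]
    ring

lemma norm_genPow_le (κ a : ℝ) {C : ℕ} (hC : 1 + |κ| + |a| ≤ C) (k N : ℕ) (n : ℤ)
    (hn : n.natAbs + C ≤ N) : ‖genPow κ a k n‖ ≤ 2 ^ k * ((N + 1).ascFactorial k : ℝ) := by
  induction k generalizing n N with
  | zero => simp [genPow, norm_e]
  | succ k ih =>
    have habs : ‖(n : ℂ)‖ = (n.natAbs : ℝ) := by
      rw [Complex.norm_intCast, Nat.cast_natAbs, Int.cast_abs]
    have hN : (n.natAbs : ℝ) + C ≤ N := by exact_mod_cast hn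
    have hup : ‖genUp κ a n‖ ≤ N := by
      refine (norm_add_le _ _).trans ?_
      have := norm_add_le (n : ℂ) κ
      simp only [Complex.norm_mul, Complex.norm_I, Complex.norm_real, Real.norm_eq_abs,
        one_mul] at *
      linarith
    have hdown : ‖genDown κ a n‖ ≤ N := by
      refine (norm_sub_le _ _).trans ?_
      have h₁ := norm_add_le ((n : ℂ) - 1) κ
      have h₂ := norm_sub_le (n : ℂ) 1
      simp only [Complex.norm_mul, Complex.norm_I, Complex.norm_real, Real.norm_eq_abs,
        one_mul, norm_one] at *
      linarith
    have h₁ := ih (N + 1) (n + 1) (by lia)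
    have h₂ := ih (N + 1) (n - 1) (by lia)
    set b : ℝ := 2 ^ k * ((N + 1 + 1).ascFactorial k : ℝ) with hb
    have hb0 : 0 ≤ b := by positivity
    calc ‖genPow κ a (k + 1) n‖ ≤ N * b + N * b := by
          rw [genPow]
          refine (norm_sub_le _ _).trans ?_
          rw [norm_smul, norm_smul]
          gcongr
      _ ≤ 2 * (N + 1 : ℝ) * b := by nlinarith
      _ = _ := by
          rw [hb, Nat.ascFactorial_succ, ← Nat.succ_ascFactorial]
          push_cast
          ring

/-- The exponential series of the generator applied to the standard basis. -/
def genExp (κ a : ℝ) (n : ℤ) (t : ℂ) : H :=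
  ∑' k : ℕ, ((k.factorial : ℂ)⁻¹ * t ^ k) • genPow κ a k n

lemma genExp_zero (κ a : ℝ) (n : ℤ) : genExp κ a n 0 = e n := by
  rw [genExp, tsum_eq_single 0]
  · simp [genPow]
  · intro k hk
    simp [hk]

lemma exists_summable_genExp_bound (κ a : ℝ) (n : ℤ) :
    ∃ u : ℕ → ℝ, Summable u ∧ ∀ (k : ℕ), ∀ t ∈ Metric.ball (0 : ℂ) (1 / 4),
      ‖((k.factorial : ℂ)⁻¹ * t ^ k) • genPow κ a k n‖ ≤ u k := by
  obtain ⟨C, hC⟩ := exists_nat_ge (1 + |κ| + |a|)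
  set N := n.natAbs + C with hN
  refine ⟨fun k => ((k + N).choose N : ℝ) * (1 / 2) ^ k,
    summable_choose_mul_geometric_of_norm_lt_one N (by norm_num), fun k t ht => ?_⟩
  have ht' : ‖t‖ ≤ 1 / 4 := by simpa using (Metric.mem_ball.1 ht).le
  have hb := norm_genPow_le κ a hC k N n le_rfl
  rw [Nat.ascFactorial_eq_factorial_mul_choose, ← Nat.choose_symm_add, add_comm N k] at hb
  have hk : (k.factorial : ℝ) ≠ 0 := by positivity
  calc ‖((k.factorial : ℂ)⁻¹ * t ^ k) • genPow κ a k n‖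
      = (k.factorial : ℝ)⁻¹ * ‖t‖ ^ k * ‖genPow κ a k n‖ := by simp [norm_smul]
    _ ≤ (k.factorial : ℝ)⁻¹ * (1 / 4) ^ k *
          (2 ^ k * (k.factorial * (k + N).choose N : ℕ)) := by gcongr
    _ = (k + N).choose N * (1 / 2) ^ k := by
        have : (1 / 2 : ℝ) ^ k = (1 / 4) ^ k * 2 ^ k := by rw [← mul_pow]; norm_num
        rw [this]
        push_cast
        field_simp

lemma hasSum_genExp (κ a : ℝ) (n : ℤ) {t : ℂ} (ht : t ∈ Metric.ball (0 : ℂ) (1 / 4)) :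
    HasSum (fun k : ℕ => ((k.factorial : ℂ)⁻¹ * t ^ k) • genPow κ a k n) (genExp κ a n t) := by
  obtain ⟨u, hu, hb⟩ := exists_summable_genExp_bound κ a n
  exact (Summable.of_norm_bounded hu fun k => hb k t ht).hasSum

lemma hasDerivAt_genExp (κ a : ℝ) (n : ℤ) {t : ℂ} (ht : t ∈ Metric.ball (0 : ℂ) (1 / 4)) :
    HasDerivAt (genExp κ a n)
      (genUp κ a n • genExp κ a (n + 1) t - genDown κ a n • genExp κ a (n - 1) t) t := by
  obtain ⟨u, hu, hb⟩ := exists_summable_genExp_bound κ a n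
  have hterm : ∀ (k : ℕ) (s : ℂ), HasDerivAt
      (fun s : ℂ => ((k.factorial : ℂ)⁻¹ * s ^ k) • genPow κ a k n)
      (((k.factorial : ℂ)⁻¹ * (k * s ^ (k - 1))) • genPow κ a k n) s := fun k s =>
    ((hasDerivAt_pow k s).const_mul _).smul_const _
  have hdiff : ∀ k : ℕ, DifferentiableOn ℂ
      (fun s : ℂ => ((k.factorial : ℂ)⁻¹ * s ^ k) • genPow κ a k n)
      (Metric.ball 0 (1 / 4)) := fun k s _ =>
    (hterm k s).differentiableAt.differentiableWithinAt
  have hsum : HasSum _ (deriv (genExp κ a n) t) :=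
    Complex.hasSum_deriv_of_summable_norm hu hdiff Metric.isOpen_ball hb ht
  simp only [(hterm _ t).deriv] at hsum
  rw [← hasSum_nat_add_iff' 1] at hsum
  have hrhs := ((hasSum_genExp κ a (n + 1) ht).const_smul (genUp κ a n)).sub
    ((hasSum_genExp κ a (n - 1) ht).const_smul (genDown κ a n))
  have hval : deriv (genExp κ a n) t =
      genUp κ a n • genExp κ a (n + 1) t - genDown κ a n • genExp κ a (n - 1) t := by
    refine HasSum.unique (by simpa using hsum) (hrhs.congr_fun fun k => ?_)
    have hk : ((k.factorial : ℂ)) ≠ 0 := by exact_mod_cast k.factorial_ne_zero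
    have hk' : (k + 1 : ℂ) ≠ 0 := by exact_mod_cast k.succ_ne_zero
    have : (((k + 1).factorial : ℂ)⁻¹ * ((k + 1 : ℕ) * t ^ k)) = (k.factorial : ℂ)⁻¹ * t ^ k := by
      rw [Nat.factorial_succ]
      push_cast
      field_simp
    simp only [genPow, smul_sub, smul_smul, Nat.cast_add, Nat.cast_one, add_tsub_cancel_right] at *
    rw [this]
    simp only [mul_comm]
  rw [← hval]
  have := Complex.differentiableOn_tsum_of_summable_norm hu hdiff Metric.isOpen_ball hb
  exact (this.differentiableAt (Metric.isOpen_ball.mem_nhds ht)).hasDerivAt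

lemma inner_genExp_e (κ a : ℝ) (n m : ℤ) {s : ℝ} (hs : (s : ℂ) ∈ Metric.ball (0 : ℂ) (1 / 4)) :
    ⟪genExp κ a n s, e m⟫_ℂ = ⟪e n, genExp κ a m (-s)⟫_ℂ := by
  have hs' : -(s : ℂ) ∈ Metric.ball (0 : ℂ) (1 / 4) := by simpa using hs
  have h₁ := (hasSum_genExp κ a m hs').mapL (innerSL ℂ (e n))
  have h₂ := ((hasSum_genExp κ a n hs).mapL (innerSL ℂ (e m))).star
  simp only [innerSL_apply_apply, ← starRingEnd_apply, inner_conj_symm] at h₁ h₂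
  refine h₂.unique (h₁.congr_fun fun k => ?_)
  rw [inner_smul_left, inner_smul_right, inner_genPow_e, neg_pow]
  simp
  ring

lemma inner_genExp_genExp (κ a : ℝ) (n m : ℤ) {s : ℝ} {t : ℂ}
    (hs : (s : ℂ) ∈ Metric.ball (0 : ℂ) (1 / 8)) (ht : t ∈ Metric.ball (0 : ℂ) (1 / 8)) :
    ⟪genExp κ a n s, genExp κ a m t⟫_ℂ = ⟪e n, genExp κ a m (t - s)⟫_ℂ := by
  have hsub : Metric.ball (0 : ℂ) (1 / 8) ⊆ Metric.ball 0 (1 / 4) :=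
    Metric.ball_subset_ball (by norm_num)
  rw [← sub_eq_zero]
  refine eq_zero_of_hasDerivAt (r := 1 / 8) (x := genUp κ a) (y := fun m => -genDown κ a m)
    (f := fun m t => ⟪genExp κ a n s, genExp κ a m t⟫_ℂ - ⟪e n, genExp κ a m (t - s)⟫_ℂ)
    (fun m t ht => ?_) (fun m => ?_) m ht
  · have hts : t - s ∈ Metric.ball (0 : ℂ) (1 / 4) := by
      simp only [mem_ball_zero_iff] at *
      linarith [norm_sub_le t s]
    have h₁ := (innerSL ℂ (genExp κ a n s)).hasFDerivAt.comp_hasDerivAt t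
      (hasDerivAt_genExp κ a m (hsub ht))
    have h₂ := (innerSL ℂ (e n)).hasFDerivAt.comp_hasDerivAt t
      ((hasDerivAt_genExp κ a m hts).comp_sub_const t s)
    refine (h₁.sub h₂).congr_deriv ?_
    simp only [innerSL_apply_apply, inner_sub_right, inner_smul_right, smul_eq_mul]
    ring
  · simp only [genExp_zero, zero_sub]
    rw [inner_genExp_e κ a n m (hsub hs), sub_self]

lemma orthonormal_genExp (κ a : ℝ) {s : ℝ} (hs : |s| < 1 / 8) :
    Orthonormal ℂ fun n => genExp κ a n s := by
  have hs' : (s : ℂ) ∈ Metric.ball (0 : ℂ) (1 / 8) := by simpa using hs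
  rw [orthonormal_iff_ite]
  intro n m
  rw [inner_genExp_genExp κ a n m hs' hs', sub_self, genExp_zero, inner_e_e]

/-- The unitary whose columns are the exponential series of the generator. -/
lemma exists_genExp_unitary (κ a : ℝ) {s : ℝ} (hs : |s| < 1 / 8) :
    ∃ V : H ≃ₗᵢ[ℂ] H, ∀ n, V (e n) = genExp κ a n s := by
  refine exists_unitary (orthonormal_genExp κ a hs)
    (orthonormal_genExp κ a (s := -s) (by simpa using hs)) fun n m => ?_
  rw [inner_genExp_e, Complex.ofReal_neg]
  simpa using hs.trans (by norm_num)

/-- A weighted shift `T` with `[L, T] = T ^ 2 - 1` for the generator `L` is transformed by `exp L`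
into a Möbius transform of itself. -/
lemma shift_genExp {κ a : ℝ} {w : ℤ → ℂ} {T : H →L[ℂ] H}
    (hT : ∀ n, T (e n) = w n • e (n + 1))
    (hup : ∀ n, w n * genUp κ a (n + 1) - genUp κ a n * w (n + 1) = w n * w (n + 1))
    (hdown : ∀ n, genDown κ a n * w (n - 1) - w n * genDown κ a (n + 1) = -1) (n : ℤ) {t : ℂ}
    (ht : t ∈ Metric.ball (0 : ℂ) (1 / 4)) :
    T (Complex.cosh t • genExp κ a n t + (Complex.sinh t * w n) • genExp κ a (n + 1) t) =
      (Complex.cosh t * w n) • genExp κ a (n + 1) t + Complex.sinh t • genExp κ a n t := by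
  rw [← sub_eq_zero]
  refine eq_zero_of_hasDerivAt (r := 1 / 4) (x := fun n => genUp κ a n + w n)
    (y := fun m => -genDown κ a m)
    (f := fun n t =>
      T (Complex.cosh t • genExp κ a n t + (Complex.sinh t * w n) • genExp κ a (n + 1) t) -
      ((Complex.cosh t * w n) • genExp κ a (n + 1) t + Complex.sinh t • genExp κ a n t))
    (fun n t ht => ?_) (fun n => ?_) n ht
  · have h₀ := hasDerivAt_genExp κ a n ht
    have h₁ := hasDerivAt_genExp κ a (n + 1) ht
    have hc := Complex.hasDerivAt_cosh t
    have hs := Complex.hasDerivAt_sinh t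
    have hA := T.hasFDerivAt.comp_hasDerivAt t
      ((hc.smul h₀).add ((hs.mul_const (w n)).smul h₁))
    have hB := ((hc.mul_const (w n)).smul h₁).add (hs.smul h₀)
    refine (hA.sub hB).congr_deriv ?_
    have e₁ := hup n
    have e₂ := hdown n
    simp only [add_sub_cancel_right, sub_add_cancel, map_add, map_smul, map_sub]
    linear_combination (norm := module)
      (Complex.sinh t * e₁) • T (genExp κ a (n + 1 + 1) t) +
      (Complex.sinh t * e₂) • T (genExp κ a n t) -
      (Complex.cosh t * e₁) • genExp κ a (n + 1 + 1) t -
      (Complex.cosh t * e₂) • genExp κ a n t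
  · simp [genExp_zero, hT]

/-- `V` transforms `T` by the linear fractional map with matrix `!![x, y; x', y']`. -/
def Intertwines (V T : H →L[ℂ] H) (x y x' y' : ℂ) : Prop :=
  T * V * (x' • T + y' • 1) = V * (x • T + y • 1)

lemma Intertwines.mul {V₁ V₂ T : H →L[ℂ] H} {x₁ y₁ x₁' y₁' x₂ y₂ x₂' y₂' : ℂ}
    (h₂ : Intertwines V₂ T x₂ y₂ x₂' y₂') (h₁ : Intertwines V₁ T x₁ y₁ x₁' y₁') :
    Intertwines (V₂ * V₁) T (x₂ * x₁ + y₂ * x₁') (x₂ * y₁ + y₂ * y₁')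
      (x₂' * x₁ + y₂' * x₁') (x₂' * y₁ + y₂' * y₁') := by
  unfold Intertwines at *
  have hcomb : ∀ u v : ℂ, V₁ * ((u * x₁ + v * x₁') • T + (u * y₁ + v * y₁') • (1 : H →L[ℂ] H)) =
      (u • T + v • 1) * (V₁ * (x₁' • T + y₁' • 1)) := by
    intro u v
    calc _ = u • (V₁ * (x₁ • T + y₁ • 1)) + v • (V₁ * (x₁' • T + y₁' • 1)) := by
          simp only [mul_add, mul_smul_comm, mul_one]
          module
      _ = _ := by
          rw [← h₁]
          simp only [add_mul, smul_mul_assoc, one_mul, mul_assoc]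
  rw [mul_assoc V₂ V₁, hcomb, ← mul_assoc T V₂, mul_assoc (T * V₂), hcomb, ← mul_assoc, h₂,
    mul_assoc]

lemma Intertwines.smul {V T : H →L[ℂ] H} {x y x' y' : ℂ} (h : Intertwines V T x y x' y') (u : ℂ) :
    Intertwines V T (u * x) (u * y) (u * x') (u * y') := by
  unfold Intertwines at *
  simp only [mul_smul u, ← smul_add, mul_smul_comm, h]

/-- Diagonal unitaries rotate every weighted shift. -/
lemma exists_rotation {u : ℂ} (hu : ‖u‖ = 1) :
    ∃ D : H ≃ₗᵢ[ℂ] H, ∀ (w : ℤ → ℂ) (T : H →L[ℂ] H), (∀ n, T (e n) = w n • e (n + 1)) →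
      Intertwines D.toContinuousLinearEquiv T u 0 0 1 := by
  have ho : ∀ v : ℂ, ‖v‖ = 1 → Orthonormal ℂ fun n : ℤ => v ^ n • e n := fun v hv => by
    refine ⟨fun n => by simp [norm_smul, hv, norm_e], fun m n hmn => ?_⟩
    simp [inner_smul_left, inner_smul_right, inner_e_e, hmn]
  have hu0 : u ≠ 0 := by
    rintro rfl
    simp at hu
  obtain ⟨D, hD⟩ := exists_unitary (ho u⁻¹ (by simp [hu])) (ho u hu) fun n m => by
    rw [inner_smul_left, inner_smul_right, inner_e_e]
    split_ifs with h
    · subst h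
      simp [Complex.inv_eq_conj hu]
    · simp
  refine ⟨D, fun w T hT => ext_e fun n => ?_⟩
  simp [hT, hD, smul_smul, zpow_add₀ hu0]
  field_simp

/-- Iterated boosts: a unitary transforming every admissible weighted shift by the hyperbolic
rotation of an arbitrary real parameter. -/
lemma exists_boost (κ a t : ℝ) :
    ∃ V : H ≃ₗᵢ[ℂ] H, ∀ (w : ℤ → ℂ) (T : H →L[ℂ] H), (∀ n, T (e n) = w n • e (n + 1)) →
      (∀ n, w n * genUp κ a (n + 1) - genUp κ a n * w (n + 1) = w n * w (n + 1)) →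
      (∀ n, genDown κ a n * w (n - 1) - w n * genDown κ a (n + 1) = -1) →
      Intertwines V.toContinuousLinearEquiv T (Complex.cosh t) (Complex.sinh t)
        (Complex.sinh t) (Complex.cosh t) := by
  obtain ⟨N, hN⟩ := exists_nat_gt (8 * |t|)
  have hN0 : (0 : ℝ) < N := lt_of_le_of_lt (by positivity) hN
  have hs : |t / N| < 1 / 8 := by
    rw [abs_div, Nat.abs_cast, div_lt_iff₀ hN0]
    linarith
  have hs' : ((t / N : ℝ) : ℂ) ∈ Metric.ball (0 : ℂ) (1 / 4) := by
    rw [mem_ball_zero_iff, Complex.norm_real, Real.norm_eq_abs]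
    linarith
  obtain ⟨V, hV⟩ := exists_genExp_unitary κ a hs
  suffices h : ∀ k : ℕ, ∃ U : H ≃ₗᵢ[ℂ] H, ∀ (w : ℤ → ℂ) (T : H →L[ℂ] H),
      (∀ n, T (e n) = w n • e (n + 1)) →
      (∀ n, w n * genUp κ a (n + 1) - genUp κ a n * w (n + 1) = w n * w (n + 1)) →
      (∀ n, genDown κ a n * w (n - 1) - w n * genDown κ a (n + 1) = -1) →
      Intertwines U.toContinuousLinearEquiv T (Complex.cosh (k * (t / N : ℝ)))
        (Complex.sinh (k * (t / N : ℝ))) (Complex.sinh (k * (t / N : ℝ)))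
        (Complex.cosh (k * (t / N : ℝ))) by
    have hNt : (N : ℂ) * (t / N : ℝ) = t := by
      exact_mod_cast mul_div_cancel₀ t hN0.ne'
    simpa only [hNt] using h N
  intro k
  induction k with
  | zero =>
    refine ⟨LinearIsometryEquiv.refl ℂ H, fun w T _ _ _ => ?_⟩
    ext x
    simp
  | succ k ih =>
    obtain ⟨U, hU⟩ := ih
    refine ⟨V.trans U, fun w T hT hup hdown => ?_⟩
    have hVT : Intertwines V.toContinuousLinearEquiv T (Complex.cosh (t / N : ℝ))
        (Complex.sinh (t / N : ℝ)) (Complex.sinh (t / N : ℝ)) (Complex.cosh (t / N : ℝ)) := by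
      refine ext_e fun n => ?_
      have := shift_genExp hT hup hdown n hs'
      simp [hT, hV, smul_smul] at this ⊢
      linear_combination (norm := module) this
    rw [show ((V.trans U).toContinuousLinearEquiv : H →L[ℂ] H) =
      U.toContinuousLinearEquiv * V.toContinuousLinearEquiv from rfl]
    convert (hU w T hT hup hdown).mul hVT using 1 <;> push_cast <;> rw [add_mul, one_mul]
    all_goals simp only [Complex.cosh_add, Complex.sinh_add]
    all_goals ring

/-- The boosts and rotations generate all Möbius transforms. -/
lemma exists_mobius_unitary (κ a θ : ℝ) {c : ℂ} (hc : ‖c‖ < 1) :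
    ∃ V : H ≃ₗᵢ[ℂ] H, ∀ (w : ℤ → ℂ) (T : H →L[ℂ] H), (∀ n, T (e n) = w n • e (n + 1)) →
      (∀ n, w n * genUp κ a (n + 1) - genUp κ a n * w (n + 1) = w n * w (n + 1)) →
      (∀ n, genDown κ a n * w (n - 1) - w n * genDown κ a (n + 1) = -1) →
      T * V.toContinuousLinearEquiv * (1 - (starRingEnd ℂ c) • T) =
        V.toContinuousLinearEquiv * (Complex.exp (θ * Complex.I) • (T - c • 1)) := by
  obtain ⟨η, hη⟩ : ∃ η : ℂ, ‖η‖ = 1 ∧ c = ‖c‖ * η :=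
    ⟨Complex.exp (c.arg * Complex.I), Complex.norm_exp_ofReal_mul_I _,
      (Complex.norm_mul_exp_arg_mul_I c).symm⟩
  obtain ⟨hη, hcη⟩ := hη
  have hconj : (starRingEnd ℂ) η * η = 1 := by
    rw [mul_comm, Complex.mul_conj', hη]
    simp
  set ε := Complex.exp (θ * Complex.I) with hε
  have hε1 : ‖ε‖ = 1 := Complex.norm_exp_ofReal_mul_I θ
  obtain ⟨t, ht⟩ : ∃ t : ℝ, Real.tanh t = -‖c‖ :=
    ⟨Real.artanh (-‖c‖), Real.tanh_artanh ⟨by linarith, by linarith [norm_nonneg c]⟩⟩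
  have hch : Complex.cosh t ≠ 0 := by
    rw [← Complex.ofReal_cosh]
    exact_mod_cast (Real.cosh_pos t).ne'
  have hth : (Complex.cosh t)⁻¹ * Complex.sinh t = -‖c‖ := by
    rw [← Complex.ofReal_cosh, ← Complex.ofReal_sinh]
    rw [Real.tanh_eq_sinh_div_cosh] at ht
    norm_cast
    rw [← ht]
    ring
  obtain ⟨D₁, hD₁⟩ := exists_rotation (u := ε * η) (by simp [hε1, hη])
  obtain ⟨D₂, hD₂⟩ := exists_rotation (u := (starRingEnd ℂ) η) (by simp [hη])
  obtain ⟨V, hV⟩ := exists_boost κ a t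
  refine ⟨(D₂.trans V).trans D₁, fun w T hT hup hdown => ?_⟩
  have h := ((hD₁ w T hT).mul ((hV w T hT hup hdown).mul (hD₂ w T hT))).smul (Complex.cosh t)⁻¹
  have hcconj : (starRingEnd ℂ) c = ‖c‖ * (starRingEnd ℂ) η := by
    conv_lhs => rw [hcη]
    simp
  have hx : (Complex.cosh t)⁻¹ * (Complex.cosh t) = 1 := inv_mul_cancel₀ hch
  have hcon : Intertwines ((D₂.trans V).trans D₁).toContinuousLinearEquiv T ε (-(ε * c))
      (-(starRingEnd ℂ) c) 1 := by
    rw [show (((D₂.trans V).trans D₁).toContinuousLinearEquiv : H →L[ℂ] H) =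
      D₁.toContinuousLinearEquiv * (V.toContinuousLinearEquiv * D₂.toContinuousLinearEquiv)
      from rfl]
    convert h using 1
    · linear_combination (-ε) * hconj - ε * η * (starRingEnd ℂ) η * hx
    · linear_combination (-ε) * hcη - ε * η * hth
    · linear_combination -hcconj - (starRingEnd ℂ) η * hth
    · linear_combination -hx
  unfold Intertwines at hcon
  convert hcon using 2
  · module
  · module

/-- The upper triangular operators similar to `diag(X, Y)` via `!![1, s; 0, 1]`. -/
def blockHom (s : ℂ) : (H →L[ℂ] H) × (H →L[ℂ] H) →ₐ[ℂ] WithLp 2 (H × H) →L[ℂ] WithLp 2 (H × H) :=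
  AlgHom.ofLinearMap
    { toFun := fun A => blockOp A.1 (s • (A.1 - A.2)) A.2
      map_add' := fun A B => by
        refine ContinuousLinearMap.ext fun x => WithLp.ofLp_injective 2 (Prod.ext ?_ ?_)
        · simp [blockOp]
          module
        · simp [blockOp]
      map_smul' := fun r A => by
        refine ContinuousLinearMap.ext fun x => WithLp.ofLp_injective 2 (Prod.ext ?_ ?_)
        · simp [blockOp]
          module
        · simp [blockOp] }
    (by
      refine ContinuousLinearMap.ext fun x => WithLp.ofLp_injective 2 (Prod.ext ?_ ?_) <;> simp [blockOp])
    (fun A B => by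
      refine ContinuousLinearMap.ext fun x => WithLp.ofLp_injective 2 (Prod.ext ?_ ?_)
      · simp [blockOp]
        module
      · simp [blockOp])

lemma blockHom_apply (s : ℂ) (X Y : H →L[ℂ] H) :
    blockHom s (X, Y) = blockOp X (s • (X - Y)) Y := rfl

lemma wB_denom_ne_zero (l : ℝ) {a : ℝ} (ha : a ≠ 0) (n : ℤ) :
    (n : ℂ) + (1 + (l : ℂ)) / 2 - Complex.I * (a : ℂ) ≠ 0 := fun h => by
  have := congrArg Complex.im h
  simp at this
  exact ha this

lemma norm_wB (l : ℝ) {a : ℝ} (ha : a ≠ 0) (n : ℤ) : ‖wB l a n‖ = 1 := by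
  have hconj : (n : ℂ) + (1 + (l : ℂ)) / 2 + Complex.I * (a : ℂ) =
      (starRingEnd ℂ) ((n : ℂ) + (1 + (l : ℂ)) / 2 - Complex.I * (a : ℂ)) := by
    simp [Complex.conj_ofNat]
  rw [wB, hconj, norm_div, RCLike.norm_conj, div_self]
  exact norm_ne_zero_iff.2 (wB_denom_ne_zero l ha n)

lemma isUnit_one_sub_smul {E : Type*} [NormedAddCommGroup E] [NormedSpace ℂ E] [CompleteSpace E]
    {T : E →L[ℂ] E} (hT : spectrum ℂ T ⊆ Metric.closedBall 0 1) {c : ℂ} (hc : ‖c‖ < 1) :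
    IsUnit (1 - (starRingEnd ℂ c) • T) := by
  rcases eq_or_ne c 0 with rfl | hc0
  · simp
  have hc0' : (starRingEnd ℂ) c ≠ 0 := by simpa using hc0
  have hmem : ((starRingEnd ℂ) c)⁻¹ ∉ spectrum ℂ T := fun hmem => by
    have := hT hmem
    rw [mem_closedBall_zero_iff, norm_inv, RCLike.norm_conj] at this
    exact absurd ((one_lt_inv₀ (norm_pos_iff.2 hc0)).2 hc) this.not_gt
  rw [spectrum.notMem_iff] at hmem
  have := hmem.smul (Units.mk0 _ hc0')
  rwa [Units.smul_def, Units.val_mk0, smul_sub, Algebra.algebraMap_eq_smul_one, smul_smul,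
    mul_inv_cancel₀ hc0', one_smul] at this

lemma unitarilyEquiv_mobius {E : Type*} [NormedAddCommGroup E] [NormedSpace ℂ E] [CompleteSpace E]
    {T : E →L[ℂ] E} {θ : ℝ} {c : ℂ} (hu : IsUnit (1 - (starRingEnd ℂ c) • T)) (U : E ≃ₗᵢ[ℂ] E)
    {V : E →L[ℂ] E} (hUV : ∀ x, U x = V x)
    (h : T * V * (1 - (starRingEnd ℂ c) • T) =
      V * (Complex.exp (θ * Complex.I) • (T - c • 1))) :
    UnitarilyEquiv (mobius θ c T) T := by
  refine ⟨U, fun x => ?_⟩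
  have hmul : V * mobius θ c T = T * V := by
    rw [mobius, ← smul_mul_assoc, ← mul_assoc, ← h, mul_assoc, Ring.mul_inverse_cancel _ hu,
      mul_one]
  rw [hUV, hUV]
  exact congrArg (fun A : E →L[ℂ] E => A x) hmul

lemma AlgHom.map_mobius_relation {A B : Type*} [Ring A] [Ring B] [Algebra ℂ A] [Algebra ℂ B]
    (φ : A →ₐ[ℂ] B) {T V : A} {b c d : ℂ}
    (h : T * V * (1 - b • T) = V * (d • (T - c • 1))) :
    φ T * φ V * (1 - b • φ T) = φ V * (d • (φ T - c • 1)) := by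
  simpa only [map_mul, map_sub, map_smul, map_one] using congrArg φ h

/-- the operator `B(λ, ia, α)` is homogeneous. -/
theorem stmt10 (l a : ℝ) (hl : -1 < l ∧ l ≤ 1) (ha : a ≠ 0) (α : ℂ)
    (B₀ B₁ : H →L[ℂ] H)
    (hB₀ : ∀ n : ℤ, B₀ (e n) = e (n + 1))
    (hB₁ : ∀ n : ℤ, B₁ (e n) = wB l a n • e (n + 1)) :
    Homogeneous (blockOp B₁ (α • (B₁ - B₀)) B₀) := by
  rw [← blockHom_apply]
  have hw₁ := norm_wB l ha
  have hT₀ : ∀ n : ℤ, B₀ (e n) = (1 : ℂ) • e (n + 1) := fun n => by rw [hB₀, one_smul]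
  have hspec : spectrum ℂ (blockHom α (B₁, B₀)) ⊆ Metric.closedBall 0 1 := by
    refine (AlgHom.spectrum_apply_subset (blockHom α) _).trans ?_
    rw [Prod.spectrum_eq]
    have : Nontrivial H := ⟨e 0, 0, fun h => by simpa [h] using norm_e 0⟩
    exact Set.union_subset
      ((spectrum.subset_closedBall_norm B₁).trans
        (Metric.closedBall_subset_closedBall (norm_shift_le hw₁ hB₁)))
      ((spectrum.subset_closedBall_norm B₀).trans
        (Metric.closedBall_subset_closedBall (norm_shift_le (fun _ => norm_one) hT₀)))
  refine ⟨hspec, fun θ c hc => ?_⟩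
  have hu := isUnit_one_sub_smul hspec hc
  obtain ⟨V, hV⟩ := exists_mobius_unitary ((1 + l) / 2) a θ hc
  have hden := wB_denom_ne_zero l ha
  refine ⟨hu, unitarilyEquiv_mobius hu (LinearIsometryEquiv.withLpProdCongr 2 V V)
    (V := blockHom α (V.toContinuousLinearEquiv, V.toContinuousLinearEquiv))
    (fun x => WithLp.ofLp_injective 2 (by simp [blockHom_apply, blockOp]))
    ((blockHom α).map_mobius_relation (Prod.ext (hV _ _ hB₁ ?_ ?_) (hV _ _ hT₀ ?_ ?_)))⟩
  · intro n
    have h₁ := hden n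
    have h₂ := hden (n + 1)
    push_cast at h₂
    have hx : (n : ℂ) + 1 + (1 + (l : ℂ)) / 2 = (n + (1 + (l : ℂ)) / 2) + 1 := by ring
    simp only [wB, genUp]
    push_cast
    rw [hx] at h₂ ⊢
    generalize (n : ℂ) + (1 + (l : ℂ)) / 2 = x at *
    field_simp
    ring
  · intro n
    have h₁ := hden n
    have h₂ := hden (n - 1)
    push_cast at h₂
    have hx : (n : ℂ) - 1 + (1 + (l : ℂ)) / 2 = (n + (1 + (l : ℂ)) / 2) - 1 := by ring
    simp only [wB, genDown]
    push_cast
    have hx' : (n : ℂ) + 1 - 1 + (1 + (l : ℂ)) / 2 = n + (1 + (l : ℂ)) / 2 := by ring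
    rw [hx] at h₂
    simp only [hx, hx']
    clear hx hx'
    generalize (n : ℂ) + (1 + (l : ℂ)) / 2 = x at *
    field_simp
    ring
  · intro n
    simp only [genUp]
    push_cast
    ring
  · intro n
    simp only [genDown]
    push_cast
    ring
end
end

section
/- Let K be a complex Hilbert space, let T₁ and T₂ be bounded operators on K, let α ∈ ℂ, let θ ∈ ℝ, and let c ∈ ℂ with |c| < 1. Suppose that 1 − conj(c)·T₁ and 1 − conj(c)·T₂ are invertible, and that U is a unitary operator on K satisfying U* Tᵢ U = e^{iθ}(Tᵢ − c·1)(1 − conj(c)·Tᵢ)⁻¹ for i = 1, 2. Let M be the operator on K ⊕ K given in block form by [[T₁, α(T₁ − T₂)], [0, T₂]]. Then 1 − conj(c)·M is invertible and (U ⊕ U)* M (U ⊕ U) = e^{iθ}(M − c·1)(1 − conj(c)·M)⁻¹. -/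
noncomputable section

open ContinuousLinearMap

theorem blockOp_apply {E : Type*} [NormedAddCommGroup E] [NormedSpace ℂ E]
    (T₁ S T₂ : E →L[ℂ] E) (x : WithLp 2 (E × E)) :
    blockOp T₁ S T₂ x = WithLp.toLp 2 (T₁ x.fst + S x.snd, T₂ x.snd) :=
  rfl

/-- The algebra homomorphism `(T₁, T₂) ↦ [[T₁, α(T₁ - T₂)], [0, T₂]]`. -/
def blockAlgHom {E : Type*} [NormedAddCommGroup E] [NormedSpace ℂ E] (α : ℂ) :
    (E →L[ℂ] E) × (E →L[ℂ] E) →ₐ[ℂ] (WithLp 2 (E × E) →L[ℂ] WithLp 2 (E × E)) :=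
  AlgHom.ofLinearMap
    { toFun := fun T => blockOp T.1 (α • (T.1 - T.2)) T.2
      map_add' := fun S T => by
        ext x
        refine WithLp.ofLp_injective 2 (Prod.ext ?_ ?_)
        · simp [blockOp_apply]
          module
        · simp [blockOp_apply]
      map_smul' := fun r T => by
        ext x
        refine WithLp.ofLp_injective 2 (Prod.ext ?_ ?_)
        · simp [blockOp_apply]
          module
        · simp [blockOp_apply] }
    (by
      ext x
      refine WithLp.ofLp_injective 2 (Prod.ext ?_ ?_) <;> simp [blockOp_apply])
    (fun S T => by
      ext x
      refine WithLp.ofLp_injective 2 (Prod.ext ?_ ?_)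
      · simp [blockOp_apply]
        module
      · simp [blockOp_apply])

theorem blockAlgHom_apply {E : Type*} [NormedAddCommGroup E] [NormedSpace ℂ E] (α : ℂ)
    (T₁ T₂ : E →L[ℂ] E) :
    blockAlgHom α (T₁, T₂) = blockOp T₁ (α • (T₁ - T₂)) T₂ :=
  rfl

theorem blockAlgHom_diag {E : Type*} [NormedAddCommGroup E] [NormedSpace ℂ E] (α : ℂ)
    (T : E →L[ℂ] E) : blockAlgHom α (T, T) = blockOp T 0 T := by
  rw [blockAlgHom_apply, sub_self, smul_zero]

theorem adjoint_blockOp_diag {E : Type*} [NormedAddCommGroup E] [InnerProductSpace ℂ E]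
    [CompleteSpace E] (T₁ T₂ : E →L[ℂ] E) :
    adjoint (blockOp T₁ 0 T₂) = blockOp (adjoint T₁) 0 (adjoint T₂) := by
  symm
  rw [eq_adjoint_iff]
  intro x y
  simp [blockOp_apply, WithLp.prod_inner_apply, adjoint_inner_left]

theorem isUnit_one_sub_smul_blockOp {E : Type*} [NormedAddCommGroup E] [NormedSpace ℂ E]
    {T₁ T₂ : E →L[ℂ] E} (α : ℂ) {z : ℂ} (h₁ : IsUnit (1 - z • T₁)) (h₂ : IsUnit (1 - z • T₂)) :
    IsUnit (1 - z • blockOp T₁ (α • (T₁ - T₂)) T₂) := by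
  have h : IsUnit (1 - z • (T₁, T₂)) := Prod.isUnit_iff.mpr ⟨h₁, h₂⟩
  simpa only [map_sub, map_one, map_smul, blockAlgHom_apply] using h.map (blockAlgHom α)

theorem mobius_eq_of_mul_eq {E : Type*} [NormedAddCommGroup E] [NormedSpace ℂ E]
    [CompleteSpace E] {θ : ℝ} {c : ℂ} {T X : E →L[ℂ] E}
    (h : IsUnit (1 - (starRingEnd ℂ c) • T))
    (hX : X * (1 - (starRingEnd ℂ c) • T) = Complex.exp (θ * Complex.I) • (T - c • 1)) :
    mobius θ c T = X := by
  rw [mobius, ← smul_mul_assoc, ← hX, Ring.mul_inverse_cancel_right _ _ h]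

theorem mobius_mul {E : Type*} [NormedAddCommGroup E] [NormedSpace ℂ E]
    [CompleteSpace E] (θ : ℝ) {c : ℂ} {T : E →L[ℂ] E}
    (h : IsUnit (1 - (starRingEnd ℂ c) • T)) :
    mobius θ c T * (1 - (starRingEnd ℂ c) • T) = Complex.exp (θ * Complex.I) • (T - c • 1) := by
  rw [mobius, smul_mul_assoc, Ring.inverse_mul_cancel_right _ _ h]

theorem mobius_blockOp {E : Type*} [NormedAddCommGroup E] [NormedSpace ℂ E] [CompleteSpace E]
    {T₁ T₂ : E →L[ℂ] E} (α : ℂ) (θ : ℝ) {c : ℂ}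
    (h₁ : IsUnit (1 - (starRingEnd ℂ c) • T₁)) (h₂ : IsUnit (1 - (starRingEnd ℂ c) • T₂)) :
    mobius θ c (blockOp T₁ (α • (T₁ - T₂)) T₂) =
      blockAlgHom α (mobius θ c T₁, mobius θ c T₂) := by
  refine mobius_eq_of_mul_eq (isUnit_one_sub_smul_blockOp α h₁ h₂) ?_
  have h : (mobius θ c T₁, mobius θ c T₂) * (1 - (starRingEnd ℂ c) • (T₁, T₂)) =
      Complex.exp (θ * Complex.I) • ((T₁, T₂) - c • 1) :=
    Prod.ext (mobius_mul θ h₁) (mobius_mul θ h₂)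
  simpa only [map_mul, map_sub, map_one, map_smul, ← blockAlgHom_apply] using
    congrArg (blockAlgHom α) h

/-- if `U* Tᵢ U` is the Möbius transform of `Tᵢ` for `i = 1, 2`, then
`(U ⊕ U)* M (U ⊕ U)` is the Möbius transform of the block operator
`M = [[T₁, α(T₁ - T₂)], [0, T₂]]`. -/
theorem stmt14 {K : Type*} [NormedAddCommGroup K] [InnerProductSpace ℂ K] [CompleteSpace K]
    (T₁ T₂ : K →L[ℂ] K) (α : ℂ) (θ : ℝ) (c : ℂ) (hc : ‖c‖ < 1)
    (h₁ : IsUnit (1 - (starRingEnd ℂ c) • T₁)) (h₂ : IsUnit (1 - (starRingEnd ℂ c) • T₂))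
    (U : K →L[ℂ] K)
    (hU₁ : U ∘L ContinuousLinearMap.adjoint U = 1)
    (hU₂ : ContinuousLinearMap.adjoint U ∘L U = 1)
    (hT₁ : ContinuousLinearMap.adjoint U ∘L T₁ ∘L U = mobius θ c T₁)
    (hT₂ : ContinuousLinearMap.adjoint U ∘L T₂ ∘L U = mobius θ c T₂) :
    IsUnit (1 - (starRingEnd ℂ c) • blockOp T₁ (α • (T₁ - T₂)) T₂) ∧
      ContinuousLinearMap.adjoint (blockOp U 0 U) ∘L
          blockOp T₁ (α • (T₁ - T₂)) T₂ ∘L blockOp U 0 U =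
        mobius θ c (blockOp T₁ (α • (T₁ - T₂)) T₂) := by
  refine ⟨isUnit_one_sub_smul_blockOp α h₁ h₂, ?_⟩
  rw [mobius_blockOp α θ h₁ h₂, ← hT₁, ← hT₂, adjoint_blockOp_diag, ← blockAlgHom_diag α,
    ← blockAlgHom_diag α, ← blockAlgHom_apply]
  simp only [← mul_def, ← map_mul, Prod.mk_mul_mk]
end
end
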